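/- arXiv:0706.3478 — 2 statements merged into one kernel-verified Lean document; each statement's English description precedes it below -/
import Mathlib

section
/- Let f ∈ ℚ[y₁, y₂, …] be homogeneous of degree d for the grading with d(y_k) = 1 and homogeneous of degree δ for the grading with δ(y_k) = k. Then ℰ₁(f)(𝟙) = d(d−1)·f(𝟙) and ℰ₂(f)(𝟙) = δ(d−1)·f(𝟙). -/
/- We model the polynomial ring `ℚ[y₁, y₂, …]` as `MvPolynomial ℕ ℚ`, the variable of
index `v` representing `y_{v+1}` (so `y_k = X (k-1)` for `k ≥ 1`). -/

open MvPolynomial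

noncomputable section

/-- `ℰ₁ = ∑_{m,n ≥ 1} y_{m+n} ∂_m ∂_n`; in our indexing, with `a = m−1`, `b = n−1`,
this is `∑_{a,b ≥ 0} X(a+b+1) ∂_{X a} ∂_{X b}` (cut off beyond the variables occurring
in the argument, losing no nonzero terms). -/
def E1 (p : MvPolynomial ℕ ℚ) : MvPolynomial ℕ ℚ :=
  ∑ a ∈ Finset.range (p.vars.sup id + 1), ∑ b ∈ Finset.range (p.vars.sup id + 1),
    X (a + b + 1) * pderiv a (pderiv b p)

/-- `ℰ₂ = ∑_{m,n ≥ 1} ((m+n)/2)·y_{m+n} ∂_m ∂_n`. -/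
def E2 (p : MvPolynomial ℕ ℚ) : MvPolynomial ℕ ℚ :=
  ∑ a ∈ Finset.range (p.vars.sup id + 1), ∑ b ∈ Finset.range (p.vars.sup id + 1),
    (((a : ℚ) + b + 2) / 2) • (X (a + b + 1) * pderiv a (pderiv b p))

namespace MvPolynomial

variable {R σ : Type*} [CommSemiring R]

theorem vars_pderiv_subset (i : σ) (φ : MvPolynomial σ R) : (pderiv i φ).vars ⊆ φ.vars := by
  classical
  intro j hj
  obtain ⟨m, hm, hjm⟩ := (mem_vars_iff_mem_support j).1 hj
  rw [mem_support_iff, coeff_pderiv] at hm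
  refine (mem_vars_iff_mem_support j).2 ⟨m + Finsupp.single i 1,
    mem_support_iff.2 fun h => hm (by simp [h]), ?_⟩
  rw [Finsupp.mem_support_iff] at hjm ⊢
  simp [hjm]

theorem pderiv_comm {R : Type*} [CommRing R] (i j : σ) (φ : MvPolynomial σ R) :
    pderiv i (pderiv j φ) = pderiv j (pderiv i φ) := by
  classical
  have h : ⁅pderiv (R := R) i, pderiv (R := R) j⁆ = 0 := by
    refine derivation_ext fun k => ?_
    simp only [Derivation.commutator_apply, pderiv_X, Pi.single_apply, Derivation.coe_zero,
      Pi.zero_apply]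
    split_ifs <;> simp
  rw [← sub_eq_zero, ← Derivation.commutator_apply, h, Derivation.coe_zero, Pi.zero_apply]

/-- Euler's identity for weighted homogeneous polynomials, in possibly infinitely many variables. -/
theorem IsWeightedHomogeneous.sum_weight_X_mul_pderiv_of_vars_subset {φ : MvPolynomial σ R}
    {w : σ → ℕ} {n : ℕ} (h : φ.IsWeightedHomogeneous w n) {S : Finset σ} (hS : φ.vars ⊆ S) :
    ∑ i ∈ S, w i • (X i * pderiv i φ) = n • φ := by
  have expand (i : σ) : w i • (X i * pderiv i φ) =
      ∑ m ∈ φ.support, (m i * w i) • monomial m (coeff m φ) := by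
    conv_lhs => rw [φ.as_sum]
    simp_rw [map_sum, Finset.mul_sum, Finset.smul_sum, X_mul_pderiv_monomial, smul_smul, mul_comm]
  simp_rw [expand]
  rw [Finset.sum_comm]
  conv_rhs => rw [φ.as_sum, Finset.smul_sum]
  refine Finset.sum_congr rfl fun m hm => ?_
  rw [← Finset.sum_smul, ← h (mem_support_iff.1 hm), Finsupp.weight_apply,
    Finsupp.sum_of_support_subset m (fun i hi =>
      hS ((mem_vars_iff_mem_support i).2 ⟨m, hm, hi⟩)) _ (by simp)]
  simp

theorem IsWeightedHomogeneous.sum_weight_mul_eval_one_pderiv {φ : MvPolynomial σ R}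
    {w : σ → ℕ} {n : ℕ} (h : φ.IsWeightedHomogeneous w n) {S : Finset σ} (hS : φ.vars ⊆ S) :
    ∑ i ∈ S, (w i : R) * eval (fun _ => 1) (pderiv i φ) = n * eval (fun _ => 1) φ := by
  simpa [nsmul_eq_mul] using
    congrArg (eval fun _ => (1 : R)) (h.sum_weight_X_mul_pderiv_of_vars_subset hS)

theorem IsHomogeneous.sum_eval_one_pderiv_pderiv {R : Type*} [CommRing R] {φ : MvPolynomial σ R}
    {n : ℕ} (h : φ.IsHomogeneous n) {S : Finset σ} (hS : φ.vars ⊆ S) (j : σ) :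
    ∑ i ∈ S, eval (fun _ => 1) (pderiv i (pderiv j φ)) =
      ((n : R) - 1) * eval (fun _ => 1) (pderiv j φ) := by
  have euler := IsWeightedHomogeneous.sum_weight_mul_eval_one_pderiv (h.pderiv (i := j))
    ((vars_pderiv_subset j φ).trans hS)
  obtain _ | n := n
  · rw [← totalDegree_zero_iff_isHomogeneous, totalDegree_eq_zero_iff_eq_C] at h
    rw [h, pderiv_C]
    simp
  · simpa using euler

end MvPolynomial

/-- if `f` is homogeneous of degree `d` for the grading `d(y_k) = 1`
and of degree `δ` for the grading `δ(y_k) = k`, then evaluation at `𝟙` (all variables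
set to `1`) gives `ℰ₁(f)(𝟙) = d(d−1)·f(𝟙)` and `ℰ₂(f)(𝟙) = δ(d−1)·f(𝟙)`. -/
theorem stmt11 (f : MvPolynomial ℕ ℚ) (d δ : ℕ)
    (hd : f.IsHomogeneous d)
    (hδ : IsWeightedHomogeneous (fun v : ℕ => v + 1) f δ) :
    eval (fun _ => (1 : ℚ)) (E1 f) = (d : ℚ) * ((d : ℚ) - 1) * eval (fun _ => (1 : ℚ)) f ∧
    eval (fun _ => (1 : ℚ)) (E2 f) = (δ : ℚ) * ((d : ℚ) - 1) * eval (fun _ => (1 : ℚ)) f := by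
  set S := Finset.range (f.vars.sup id + 1) with hS
  have hfS : f.vars ⊆ S := fun v hv =>
    Finset.mem_range.2 (Nat.lt_succ_of_le (Finset.le_sup (f := id) hv))
  set g : ℕ → ℚ := fun b => eval (fun _ => 1) (pderiv b f)
  set F : ℕ → ℕ → ℚ := fun a b => eval (fun _ => 1) (pderiv a (pderiv b f)) with hF
  have sum_F (b : ℕ) : ∑ a ∈ S, F a b = ((d : ℚ) - 1) * g b :=
    hd.sum_eval_one_pderiv_pderiv hfS b
  have sum_g : ∑ b ∈ S, g b = d * eval (fun _ => 1) f := by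
    simpa using IsWeightedHomogeneous.sum_weight_mul_eval_one_pderiv hd hfS
  have sum_weight_g : ∑ b ∈ S, ((b : ℚ) + 1) * g b = δ * eval (fun _ => 1) f := by
    simpa using hδ.sum_weight_mul_eval_one_pderiv hfS
  have sum_weight_F : ∑ b ∈ S, ∑ a ∈ S, ((b : ℚ) + 1) * F a b =
      δ * ((d : ℚ) - 1) * eval (fun _ => 1) f := by
    simp_rw [← Finset.mul_sum, sum_F, mul_left_comm _ ((d : ℚ) - 1)]
    rw [← Finset.mul_sum, sum_weight_g]
    ring
  constructor
  · have h : eval (fun _ => (1 : ℚ)) (E1 f) = ∑ a ∈ S, ∑ b ∈ S, F a b := by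
      simp [E1, hF, hS]
    rw [h, Finset.sum_comm]
    simp_rw [sum_F]
    rw [← Finset.mul_sum, sum_g]
    ring
  · have h : eval (fun _ => (1 : ℚ)) (E2 f) =
        ∑ a ∈ S, ∑ b ∈ S, (((a : ℚ) + 1) * F b a + ((b : ℚ) + 1) * F a b) / 2 := by
      simp only [E2, map_sum, smul_eval, map_mul, eval_X, one_mul]
      refine Finset.sum_congr rfl fun a _ => Finset.sum_congr rfl fun b _ => ?_
      simp only [hF, pderiv_comm b a]
      ring
    rw [h]
    simp_rw [← Finset.sum_div, Finset.sum_add_distrib]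
    rw [Finset.sum_comm (f := fun a b : ℕ => ((b : ℚ) + 1) * F a b), sum_weight_F]
    ring
end
end

section
/- For all integers r ≥ 1 and i ≥ r, one has 𝒟^{r−1}(B(i, r)) = r!·(r−1)!·(i−r)!·Ψ(g, i, r)·x_{i+1−r} in R, where Ψ(g, i, r) = Σ_{a=0}^{r−1} binom(i−g, a)·binom(i−a, r−a)·binom(i−r−1, r−1−a). -/
/- We model `R = ℚ[x₁, x₂, …]` as `MvPolynomial ℕ ℚ`, the variable of index `v`
representing `x_{v+1}` (so `x_k = X (k-1)` for `k ≥ 1`). -/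

open MvPolynomial

noncomputable section

/-- Polishchuk's operator
`𝒟 = -g ∂₁ + (1/2) ∑_{m,n ≥ 1} binom(m+n, n) x_{m+n-1} ∂_m ∂_n` (cut off beyond the
variables occurring in the argument, losing no nonzero terms). -/
def Dop (g : ℕ) (p : MvPolynomial ℕ ℚ) : MvPolynomial ℕ ℚ :=
  -(g : ℚ) • pderiv 0 p +
    (1/2 : ℚ) •
      ∑ a ∈ Finset.range (p.vars.sup id + 1), ∑ b ∈ Finset.range (p.vars.sup id + 1),
        (((a + b + 2).choose (b + 1) : ℚ)) • (X (a + b) * pderiv a (pderiv b p))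

/-- `B(i, s) = ∑ m₁!⋯m_s!·x_{m₁}⋯x_{m_s}`, summed over ordered `s`-tuples of integers
`m_k ≥ 1` with `m₁ + ⋯ + m_s = i`. -/
def Bpol (i s : ℕ) : MvPolynomial ℕ ℚ :=
  ∑ m ∈ (Finset.Nat.antidiagonalTuple s i).filter (fun m => ∀ k, 1 ≤ m k),
    (∏ k, ((m k).factorial : ℚ)) • ∏ k, X (m k - 1)

/-- Generalized binomial coefficient `binom(z, s) = z(z−1)⋯(z−s+1)/s!` for `z : ℤ`. -/
def gbinom (z : ℤ) (s : ℕ) : ℚ :=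
  (∏ t ∈ Finset.range s, ((z : ℚ) - t)) / (Nat.factorial s)

/-- `Ψ(g, i, r) = ∑_{a=0}^{r−1} binom(i−g, a)·binom(i−a, r−a)·binom(i−r−1, r−1−a)`. -/
def Psi (g i r : ℕ) : ℚ :=
  ∑ a ∈ Finset.range r,
    gbinom ((i : ℤ) - g) a * gbinom ((i : ℤ) - a) (r - a) *
      gbinom ((i : ℤ) - r - 1) (r - 1 - a)

theorem gbinom_eq_choose (z : ℤ) (s : ℕ) : gbinom z s = Ring.choose (z : ℚ) s := by
  rw [gbinom, Ring.choose_eq_smul, ← Polynomial.aeval_eq_smeval, Polynomial.aeval_def,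
    Polynomial.eval₂_eq_eval_map, descPochhammer_map, descPochhammer_eval_eq_prod_range]
  simp [div_eq_inv_mul]

theorem gbinom_natCast (n s : ℕ) : gbinom (n : ℤ) s = n.choose s := by
  rw [gbinom_eq_choose]; exact_mod_cast Ring.choose_natCast (R := ℚ) n s

theorem gbinom_add (x y : ℤ) (n : ℕ) :
    gbinom (x + y) n = ∑ p ∈ Finset.HasAntidiagonal.antidiagonal n, gbinom x p.1 * gbinom y p.2 := by
  simp only [gbinom_eq_choose, Int.cast_add]
  exact Ring.add_choose_eq n (Commute.all (x : ℚ) (y : ℚ))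

theorem gbinom_neg (x : ℤ) (n : ℕ) : gbinom (-x) n = (-1) ^ n * gbinom (x + n - 1) n := by
  simp only [gbinom_eq_choose]
  push_cast
  rw [Ring.choose_neg]
  simp [Int.negOnePow, Units.smul_def]

theorem gbinom_sub_natCast (g i a : ℕ) (h : a ≤ i) :
    gbinom ((i : ℤ) - g) a =
      ∑ b ∈ Finset.range (a + 1), (-1) ^ b * (g.choose b : ℚ) * ((i - b).choose (a - b) : ℚ) := by
  have h1 : ((i : ℤ) - g) = -((g : ℤ) - i) := by ring
  rw [h1, gbinom_neg, show (g : ℤ) - i + a - 1 = g + -((i : ℤ) + 1 - a) by ring, gbinom_add,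
    Finset.Nat.sum_antidiagonal_eq_sum_range_succ_mk, Finset.mul_sum]
  refine Finset.sum_congr rfl fun b hb => ?_
  have hb' : b ≤ a := Nat.lt_succ_iff.mp (Finset.mem_range.mp hb)
  rw [gbinom_natCast, gbinom_neg,
    show (i : ℤ) + 1 - a + ((a - b : ℕ) : ℤ) - 1 = ((i - b : ℕ) : ℤ) by omega, gbinom_natCast]
  have h2 : ((-1 : ℚ)) ^ a * (-1) ^ (a - b) = (-1) ^ b := by
    obtain ⟨c, rfl⟩ := Nat.exists_eq_add_of_le hb'
    rw [Nat.add_sub_cancel_left, pow_add, mul_assoc, ← pow_add, ← two_mul, pow_mul]; simp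
  rw [← h2]; ring

/-- The alternating form of `Psi`. -/
theorem Psi_eq_sum (g n k : ℕ) :
    Psi g (n + (k + 1)) (k + 1) = ∑ b ∈ Finset.range (k + 1),
      (-1) ^ b * (g.choose b : ℚ) *
        (((n + (k - b)).choose (k - b) : ℚ) * ((n + (k - b) + 1).choose (k - b + 1) : ℚ)) := by
  have key : ∀ a ∈ Finset.range (k + 1),
      gbinom (((n + (k + 1) : ℕ) : ℤ) - g) a * gbinom (((n + (k + 1) : ℕ) : ℤ) - a) (k + 1 - a) *
        gbinom (((n + (k + 1) : ℕ) : ℤ) - (k + 1 : ℕ) - 1) (k + 1 - 1 - a) =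
      ∑ b ∈ Finset.range (a + 1), (-1) ^ b * (g.choose b : ℚ) *
        (((n + (k - b) + 1).choose (k - b + 1) : ℚ) *
          (((k - b + 1).choose (a - b) : ℚ) * gbinom ((n : ℤ) - 1) (k - a))) := by
    intro a ha
    have ha' : a ≤ k := Nat.lt_succ_iff.mp (Finset.mem_range.mp ha)
    rw [gbinom_sub_natCast _ _ _ (by omega), Finset.sum_mul, Finset.sum_mul]
    refine Finset.sum_congr rfl fun b hb => ?_
    have hb' : b ≤ a := Nat.lt_succ_iff.mp (Finset.mem_range.mp hb)
    rw [show (((n + (k + 1) : ℕ) : ℤ) - a) = ((n + (k + 1) - a : ℕ) : ℤ) by omega, gbinom_natCast,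
      show (((n + (k + 1) : ℕ) : ℤ) - (k + 1 : ℕ) - 1) = (n : ℤ) - 1 by push_cast; ring,
      show k + 1 - 1 - a = k - a by omega]
    have h := Nat.choose_mul (n := n + (k - b) + 1) (k := k - b + 1) (s := a - b) (by omega)
    rw [show n + (k - b) + 1 - (a - b) = n + (k + 1) - a by omega,
      show k - b + 1 - (a - b) = k + 1 - a by omega] at h
    have h' : ((n + (k - b) + 1).choose (k - b + 1) : ℚ) * ((k - b + 1).choose (a - b) : ℚ) =
      ((n + (k - b) + 1).choose (a - b) : ℚ) * ((n + (k + 1) - a).choose (k + 1 - a) : ℚ) := by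
      exact_mod_cast h
    rw [show n + (k + 1) - b = n + (k - b) + 1 by omega]
    linear_combination -(-1) ^ b * (g.choose b : ℚ) * gbinom ((n : ℤ) - 1) (k - a) * h'
  rw [Psi, Finset.sum_congr rfl key]
  rw [Finset.sum_sigma']
  rw [Finset.sum_bij' (t := (Finset.range (k + 1)).sigma fun b => Finset.range (k - b + 1))
    (g := fun x => (-1) ^ x.1 * (g.choose x.1 : ℚ) *
        (((n + (k - x.1) + 1).choose (k - x.1 + 1) : ℚ) *
          (((k - x.1 + 1).choose x.2 : ℚ) * gbinom ((n : ℤ) - 1) (k - x.1 - x.2))))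
    (i := fun x _ => ⟨x.2, x.1 - x.2⟩) (j := fun x _ => ⟨x.1 + x.2, x.1⟩)]
  · rw [Finset.sum_sigma]
    refine Finset.sum_congr rfl fun b hb => ?_
    simp only [← Finset.mul_sum]
    have h := gbinom_add ((k - b + 1 : ℕ) : ℤ) ((n : ℤ) - 1) (k - b)
    rw [Finset.Nat.sum_antidiagonal_eq_sum_range_succ_mk,
      show ((k - b + 1 : ℕ) : ℤ) + ((n : ℤ) - 1) = ((n + (k - b) : ℕ) : ℤ) by push_cast; ring,
      gbinom_natCast] at h
    simp only [gbinom_natCast] at h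
    rw [h]; ring
  · rintro ⟨a, b⟩ h
    simp only [Finset.mem_sigma, Finset.mem_range] at h ⊢
    omega
  · rintro ⟨a, b⟩ h
    simp only [Finset.mem_sigma, Finset.mem_range] at h ⊢
    omega
  · rintro ⟨a, b⟩ h
    simp only [Finset.mem_sigma, Finset.mem_range] at h ⊢
    simp only [Sigma.mk.injEq, heq_eq_eq, and_true]
    omega
  · rintro ⟨a, b⟩ h
    simp
  · rintro ⟨a, b⟩ h
    simp only [Finset.mem_sigma, Finset.mem_range] at h ⊢
    rw [show k - b - (a - b) = k - a by omega]

/-- The Narayana numbers `N(v + k + 1, k + 1)`. -/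
def narayana (v k : ℕ) : ℚ := (v + k).choose k * (v + k + 1).choose (k + 1) / (v + 1)

theorem narayana_eq_factorial (v k : ℕ) : narayana v k =
    (v + k).factorial * (v + k + 1).factorial /
      (k.factorial * v.factorial * (k + 1).factorial * (v + 1).factorial) := by
  have h1 := Nat.cast_add_choose ℚ (a := k) (b := v)
  have h2 := Nat.cast_add_choose ℚ (a := k + 1) (b := v)
  rw [narayana, show v + k + 1 = k + 1 + v by ring, add_comm v k, h1, h2,
    Nat.factorial_succ v]
  push_cast
  field_simp

theorem narayana_succ_left (v k : ℕ) : narayana (v + 1) k =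
    narayana v k * ((v + k + 1) * (v + k + 2) / ((v + 1) * (v + 2))) := by
  rw [narayana_eq_factorial, narayana_eq_factorial, show v + 1 + k = v + k + 1 by ring]
  simp only [Nat.factorial_succ]
  push_cast
  field_simp
  ring

theorem narayana_succ_right (v k : ℕ) : narayana v (k + 1) =
    narayana v k * ((v + k + 1) * (v + k + 2) / ((k + 1) * (k + 2))) := by
  rw [narayana_eq_factorial, narayana_eq_factorial, show v + (k + 1) = v + k + 1 by ring]
  simp only [Nat.factorial_succ]
  push_cast
  field_simp
  ring

theorem narayana_zero_left (k : ℕ) : narayana 0 k = 1 := by simp [narayana]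

theorem narayana_zero_right (v : ℕ) : narayana v 0 = 1 := by
  simp only [narayana, add_zero, Nat.choose_zero_right, zero_add, Nat.choose_one_right]
  push_cast
  field_simp

/-- The generating function `∑ narayana v k * w ^ k` of a row of Narayana numbers. -/
def narayanaRow (v : ℕ) : PowerSeries ℚ := PowerSeries.mk (narayana v)

/-- The bivariate generating function `∑ narayana v k * w ^ k * t ^ v`, where `t` is the outer
variable and `w` the inner one. -/
def narayanaSeries : PowerSeries (PowerSeries ℚ) := PowerSeries.mk narayanaRow

/-- Formal differentiation as a derivation over `ℚ`. -/
def ratDerivative (A : Type*) [CommRing A] [Algebra ℚ A] :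
    Derivation ℚ (PowerSeries A) (PowerSeries A) where
  toFun := PowerSeries.derivative A
  map_add' f g := map_add _ f g
  map_smul' c f := by
    ext n
    simp [PowerSeries.coeff_derivative]
  map_one_eq_zero' := PowerSeries.derivative_one
  leibniz' f g := (PowerSeries.derivative A).leibniz f g

theorem ratDerivative_apply {A : Type*} [CommRing A] [Algebra ℚ A] (f : PowerSeries A) :
    ratDerivative A f = PowerSeries.derivative A f := rfl

theorem narayanaSeries_ode {T W F : PowerSeries (PowerSeries ℚ)} (hT : T = PowerSeries.X)
    (hW : W = PowerSeries.C PowerSeries.X) (hF : F = narayanaSeries) :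
    ((1 - T - W) ^ 2 - 4 * T * W) * PowerSeries.derivative _ (T * F) =
      (1 + T - W) - (1 + W - T) * (T * F) := by
  set G := PowerSeries.derivative _ (T * F) with hG
  have hGc : ∀ v k, PowerSeries.coeff k (PowerSeries.coeff v G) = (v + 1) * narayana v k := by
    intro v k
    rw [hG, hT, PowerSeries.coeff_derivative, PowerSeries.coeff_succ_X_mul, hF, narayanaSeries,
      PowerSeries.coeff_mk, narayanaRow, mul_comm]
    have : ((v : PowerSeries ℚ) + 1) = PowerSeries.C ((v : ℚ) + 1) := by simp
    rw [this, PowerSeries.coeff_C_mul, PowerSeries.coeff_mk]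
  have hFc : ∀ v k, PowerSeries.coeff k (PowerSeries.coeff v F) = narayana v k := by
    intro v k
    simp [hF, narayanaSeries, narayanaRow]
  suffices h : G - W * G - W * G + W * (W * G) + T * (T * G) - T * G - T * G - T * (W * G)
      - T * (W * G) + T * F + W * (T * F) - T * (T * F) - T + W - 1 = 0 by
    linear_combination h
  ext v k
  subst hT hW
  clear_value G
  clear hG hF
  rcases v with _ | _ | v <;> rcases k with _ | _ | k <;>
  simp only [map_sub, map_add, PowerSeries.coeff_C_mul, PowerSeries.coeff_succ_X_mul,
    PowerSeries.coeff_zero_X_mul, hGc, hFc, map_zero, PowerSeries.coeff_X,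
    PowerSeries.coeff_C, zero_add, ite_true, ite_false, narayana_succ_right, narayana_succ_left,
    narayana_zero_left, narayana_zero_right, Nat.succ_ne_zero, apply_ite, PowerSeries.coeff_one] <;>
  push_cast <;> (try simp) <;> (try field_simp) <;> (try ring)

theorem narayanaSeries_quadratic {T W F : PowerSeries (PowerSeries ℚ)} (hT : T = PowerSeries.X)
    (hW : W = PowerSeries.C PowerSeries.X) (hF : F = narayanaSeries) :
    W * T * F ^ 2 - (1 - T - W) * F + 1 = 0 := by
  have hode := narayanaSeries_ode hT hW hF
  set D : Derivation ℚ (PowerSeries (PowerSeries ℚ)) (PowerSeries (PowerSeries ℚ)) :=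
    ratDerivative (PowerSeries ℚ) with hD
  have hDD : ∀ f, PowerSeries.derivative (PowerSeries ℚ) f = D f := fun _ => rfl
  rw [hDD] at hode
  have hDT : D T = 1 := by rw [hT, ← hDD, PowerSeries.derivative_X]
  have hDW : D W = 0 := by rw [hW, ← hDD, PowerSeries.derivative_C]
  set Δ := (1 - T - W) ^ 2 - 4 * T * W with hΔ
  set β := 1 - T - W - 2 * W * (T * F) with hβ
  have hDβ : D β = -1 - 2 * W * D (T * F) := by
    have : D 2 = 0 := D.map_natCast 2
    rw [hβ]
    simp only [map_sub, Derivation.leibniz, Derivation.map_one_eq_zero, hDT, hDW, smul_eq_mul, this]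
    ring
  have hDΔ : D Δ = 2 * (T - 1 - W) := by
    have h4 : D 4 = 0 := D.map_natCast 4
    rw [hΔ]
    simp only [map_sub, Derivation.leibniz, Derivation.leibniz_pow, Derivation.map_one_eq_zero,
      hDT, hDW, smul_eq_mul, nsmul_eq_mul, h4]
    push_cast
    ring
  have hβode : 2 * Δ * D β = D Δ * β := by
    rw [hDβ, hDΔ, hβ]
    rw [hΔ] at hode ⊢
    linear_combination (-4 * W) * hode
  have hunit : IsUnit Δ := by
    rw [PowerSeries.isUnit_iff_constantCoeff, PowerSeries.isUnit_iff_constantCoeff, hΔ, hT, hW]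
    simp
  obtain ⟨u, hu⟩ := hunit
  have huu : (↑u⁻¹ : PowerSeries (PowerSeries ℚ)) * Δ = 1 := by rw [← hu]; simp
  have hsq : β ^ 2 * (↑u⁻¹ : PowerSeries (PowerSeries ℚ)) = 1 := by
    have : IsAddTorsionFree (PowerSeries ℚ) := IsAddTorsionFree.of_module_rat _
    apply PowerSeries.derivative.ext
    · have h1 : D ((↑u⁻¹ : PowerSeries (PowerSeries ℚ)) * Δ) = 0 := by
        rw [huu, Derivation.map_one_eq_zero]
      rw [hDD, hDD, Derivation.map_one_eq_zero]
      rw [Derivation.leibniz, smul_eq_mul, smul_eq_mul] at h1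
      rw [Derivation.leibniz, Derivation.leibniz_pow]
      simp only [smul_eq_mul, nsmul_eq_mul]
      push_cast
      have : Δ * (β ^ 2 * D ↑u⁻¹ + ↑u⁻¹ * (2 * (β ^ (2 - 1) * D β))) = 0 := by
        simp only [Nat.add_one_sub_one, pow_one]
        linear_combination β ^ 2 * h1 + ↑u⁻¹ * β * hβode
      rw [← hu] at this
      exact (Units.mul_right_eq_zero u).mp this
    · have h2 : PowerSeries.constantCoeff β ^ 2 = PowerSeries.constantCoeff Δ := by
        rw [hβ, hΔ, hT, hW]; simp
      rw [map_mul, map_pow, h2, ← map_mul, mul_comm, huu]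
  have hsq' : β ^ 2 = Δ := by
    calc β ^ 2 = β ^ 2 * (↑u⁻¹ * Δ) := by rw [huu, mul_one]
      _ = Δ := by rw [← mul_assoc, hsq, one_mul]
  have hT0 : T ≠ 0 := hT ▸ PowerSeries.X_ne_zero
  have hW0 : W ≠ 0 := by
    rw [hW, Ne, map_eq_zero_iff _ PowerSeries.C_injective]; exact PowerSeries.X_ne_zero
  have h4 : (4 : PowerSeries (PowerSeries ℚ)) ≠ 0 := by
    rw [show (4 : PowerSeries (PowerSeries ℚ)) = PowerSeries.C (PowerSeries.C 4) from rfl]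
    simp [map_eq_zero_iff _ PowerSeries.C_injective]
  have : 4 * T * W * (W * T * F ^ 2 - (1 - T - W) * F + 1) = 0 := by
    rw [hβ, hΔ] at hsq'
    linear_combination hsq'
  exact (mul_eq_zero.mp this).resolve_left (mul_ne_zero (mul_ne_zero h4 hT0) hW0)

/-- The derivation of `A⟦X⟧` acting on coefficients by a derivation of `A`. -/
def Derivation.powerSeriesMap {A : Type*} [CommRing A] [Algebra ℚ A] (d : Derivation ℚ A A) :
    Derivation ℚ (PowerSeries A) (PowerSeries A) where
  toFun f := PowerSeries.mk fun n => d (PowerSeries.coeff n f)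
  map_add' f g := by ext n; simp
  map_smul' c f := by ext n; simp
  map_one_eq_zero' := by
    ext n
    simp only [LinearMap.coe_mk, AddHom.coe_mk, PowerSeries.coeff_mk, PowerSeries.coeff_one]
    split_ifs <;> simp
  leibniz' f g := by
    ext n
    simp only [LinearMap.coe_mk, AddHom.coe_mk, PowerSeries.coeff_mk, PowerSeries.coeff_mul,
      smul_eq_mul, map_sum, map_add, Derivation.leibniz, Finset.sum_add_distrib]
    rw [← Finset.Nat.sum_antidiagonal_swap (f := fun p => PowerSeries.coeff p.1 g * _)]
    rfl

@[simp]
theorem Derivation.coeff_powerSeriesMap {A : Type*} [CommRing A] [Algebra ℚ A]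
    (d : Derivation ℚ A A) (f : PowerSeries A) (n : ℕ) :
    PowerSeries.coeff n (d.powerSeriesMap f) = d (PowerSeries.coeff n f) :=
  PowerSeries.coeff_mk n fun n => d (PowerSeries.coeff n f)

theorem narayanaSeries_pde :
    (ratDerivative ℚ).powerSeriesMap narayanaSeries =
      narayanaSeries *
        PowerSeries.derivative (PowerSeries ℚ) (PowerSeries.X * narayanaSeries) := by
  have hquad := narayanaSeries_quadratic rfl rfl rfl
  set F := narayanaSeries
  set E := (ratDerivative ℚ).powerSeriesMap with hE
  set T : PowerSeries (PowerSeries ℚ) := PowerSeries.X with hT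
  set W : PowerSeries (PowerSeries ℚ) := PowerSeries.C PowerSeries.X with hW
  set D : Derivation ℚ (PowerSeries (PowerSeries ℚ)) (PowerSeries (PowerSeries ℚ)) :=
    ratDerivative (PowerSeries ℚ) with hD
  have hDD : ∀ f, PowerSeries.derivative (PowerSeries ℚ) f = D f := fun _ => rfl
  rw [hDD]
  have hDT : D T = 1 := PowerSeries.derivative_X
  have hDW : D W = 0 := PowerSeries.derivative_C
  have hET : E T = 0 := by
    ext n
    rw [hE, Derivation.coeff_powerSeriesMap, hT, PowerSeries.coeff_X]
    split_ifs <;> simp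
  have hEW : E W = 1 := by
    ext n
    rw [hE, Derivation.coeff_powerSeriesMap, hW, PowerSeries.coeff_C, PowerSeries.coeff_one]
    split_ifs <;> simp [ratDerivative_apply]
  set β := 1 - T - W - 2 * W * (T * F) with hβ
  have hβ0 : β ≠ 0 := by
    intro h
    have := congrArg (fun s => PowerSeries.constantCoeff (PowerSeries.constantCoeff s)) h
    simp [hβ, hT, hW] at this
  have h1 := congrArg D hquad
  have h2 := congrArg E hquad
  simp only [map_add, map_sub, map_zero, Derivation.leibniz, Derivation.leibniz_pow,
    Derivation.map_one_eq_zero, hDT, hDW, hET, hEW, smul_eq_mul, nsmul_eq_mul] at h1 h2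
  push_cast at h1 h2
  simp only [pow_one] at h1 h2
  apply mul_left_cancel₀ hβ0
  rw [Derivation.leibniz, hDT, hβ]
  simp only [smul_eq_mul]
  linear_combination -h2 + T * F * h1 + F * hquad

theorem two_mul_derivative_narayanaRow (n : ℕ) :
    2 * PowerSeries.derivative ℚ (narayanaRow n) =
      (n + 2) * ∑ p ∈ Finset.HasAntidiagonal.antidiagonal n, narayanaRow p.1 * narayanaRow p.2 := by
  have h := congrArg (PowerSeries.coeff n) narayanaSeries_pde
  rw [Derivation.coeff_powerSeriesMap, PowerSeries.coeff_mul, narayanaSeries,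
    PowerSeries.coeff_mk, ratDerivative_apply] at h
  simp only [PowerSeries.coeff_derivative, PowerSeries.coeff_succ_X_mul, PowerSeries.coeff_mk] at h
  have h' := h
  rw [← Finset.Nat.sum_antidiagonal_swap] at h'
  rw [two_mul]
  nth_rw 1 [h]
  rw [h', ← Finset.sum_add_distrib, Finset.mul_sum]
  refine Finset.sum_congr rfl fun p hp => ?_
  rw [← Finset.HasAntidiagonal.mem_antidiagonal.mp hp, Prod.fst_swap, Prod.snd_swap]
  push_cast
  ring

theorem Derivation.powerSeriesMap_C {A : Type*} [CommRing A] [Algebra ℚ A]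
    (d : Derivation ℚ A A) (x : A) :
    d.powerSeriesMap (PowerSeries.C x) = PowerSeries.C (d x) := by
  ext n
  rw [Derivation.coeff_powerSeriesMap, PowerSeries.coeff_C, PowerSeries.coeff_C]
  split_ifs <;> simp

theorem pderiv_pderiv_comm (a b : ℕ) (p : MvPolynomial ℕ ℚ) :
    pderiv a (pderiv b p) = pderiv b (pderiv a p) := by
  have h : ⁅(pderiv a : Derivation ℚ (MvPolynomial ℕ ℚ) (MvPolynomial ℕ ℚ)),
      (pderiv b : Derivation ℚ (MvPolynomial ℕ ℚ) (MvPolynomial ℕ ℚ))⁆ = 0 := by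
    refine MvPolynomial.derivation_ext fun i => ?_
    rw [Derivation.commutator_apply, pderiv_X, pderiv_X, Pi.single_apply, Pi.single_apply]
    split_ifs <;> simp
  have h' := congrArg (fun d => d p) h
  rwa [Derivation.commutator_apply, Derivation.zero_apply, sub_eq_zero] at h'

theorem Dop_eq_sum_range (g : ℕ) (p : MvPolynomial ℕ ℚ) {N : ℕ} (hN : p.vars.sup id + 1 ≤ N) :
    Dop g p = -(g : ℚ) • pderiv 0 p +
    (1/2 : ℚ) • ∑ a ∈ Finset.range N, ∑ b ∈ Finset.range N,
        (((a + b + 2).choose (b + 1) : ℚ)) • (X (a + b) * pderiv a (pderiv b p)) := by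
  have hz : ∀ b, b ∉ Finset.range (p.vars.sup id + 1) → pderiv b p = 0 := by
    intro b hb
    apply pderiv_eq_zero_of_notMem_vars
    intro hmem
    exact hb (Finset.mem_range.mpr (Nat.lt_succ_of_le (Finset.le_sup (f := id) hmem)))
  have hsub : Finset.range (p.vars.sup id + 1) ⊆ Finset.range N := by
    intro x; simp only [Finset.mem_range]; omega
  rw [Dop]
  congr 2
  rw [Finset.sum_subset hsub]
  · refine Finset.sum_congr rfl fun a _ => ?_
    apply Finset.sum_subset hsub
    intro b _ hb
    rw [hz b hb]; simp
  · intro a _ ha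
    refine Finset.sum_eq_zero fun b _ => ?_
    rw [pderiv_pderiv_comm, hz a ha]; simp

/-- The image of `(v + 1)! • narayanaRow v` in power series over `ℚ[x₁, x₂, …]`. -/
def scaledRow (v : ℕ) : PowerSeries (MvPolynomial ℕ ℚ) :=
  ((v + 1).factorial : PowerSeries (MvPolynomial ℕ ℚ)) * PowerSeries.map C (narayanaRow v)

/-- The series `∑ (v + 1)! * narayana v k * x_{v + 1} * w ^ k * t ^ v`. -/
def flowSeries : PowerSeries (PowerSeries (MvPolynomial ℕ ℚ)) :=
  PowerSeries.mk fun v => PowerSeries.C (X v) * scaledRow v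

/-- The series `1 - w`. -/
def oneSubInner : PowerSeries (PowerSeries (MvPolynomial ℕ ℚ)) :=
  PowerSeries.C (1 - PowerSeries.X)

/-- The partial derivative acting on the coefficients of a bivariate power series. -/
def pderivCoeff (a : ℕ) : Derivation ℚ (PowerSeries (PowerSeries (MvPolynomial ℕ ℚ)))
    (PowerSeries (PowerSeries (MvPolynomial ℕ ℚ))) :=
  (pderiv a : Derivation ℚ (MvPolynomial ℕ ℚ) (MvPolynomial ℕ ℚ)).powerSeriesMap.powerSeriesMap

/-- Differentiation with respect to the inner variable. -/
def derivInner : Derivation ℚ (PowerSeries (PowerSeries (MvPolynomial ℕ ℚ)))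
    (PowerSeries (PowerSeries (MvPolynomial ℕ ℚ))) :=
  (ratDerivative (MvPolynomial ℕ ℚ)).powerSeriesMap

theorem pderiv_powerSeriesMap_scaledRow (a v : ℕ) :
    (pderiv a : Derivation ℚ (MvPolynomial ℕ ℚ) (MvPolynomial ℕ ℚ)).powerSeriesMap
      (scaledRow v) = 0 := by
  rw [scaledRow, Derivation.leibniz, Derivation.map_natCast]
  have : (pderiv a : Derivation ℚ (MvPolynomial ℕ ℚ) (MvPolynomial ℕ ℚ)).powerSeriesMap
      (PowerSeries.map C (narayanaRow v)) = 0 := by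
    ext1 k
    rw [Derivation.coeff_powerSeriesMap, PowerSeries.coeff_map, pderiv_C, map_zero]
  rw [this]; simp

theorem pderivCoeff_oneSubInner (a : ℕ) : pderivCoeff a oneSubInner = 0 := by
  have : (pderiv a : Derivation ℚ (MvPolynomial ℕ ℚ) (MvPolynomial ℕ ℚ)).powerSeriesMap
      (1 - PowerSeries.X) = 0 := by
    ext1 k
    rw [Derivation.coeff_powerSeriesMap, map_sub, PowerSeries.coeff_one, PowerSeries.coeff_X]
    split_ifs <;> simp
  rw [pderivCoeff, oneSubInner, Derivation.powerSeriesMap_C, this, map_zero]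

theorem pderivCoeff_flowSeries (a : ℕ) :
    pderivCoeff a flowSeries = PowerSeries.monomial a (scaledRow a) := by
  ext1 v
  rw [pderivCoeff, Derivation.coeff_powerSeriesMap, flowSeries, PowerSeries.coeff_mk,
    Derivation.leibniz, pderiv_powerSeriesMap_scaledRow, Derivation.powerSeriesMap_C,
    PowerSeries.coeff_monomial, pderiv_X]
  split_ifs with h
  · subst h; simp
  · simp [h]

theorem pderivCoeff_monomial_scaledRow (a b : ℕ) :
    pderivCoeff b (PowerSeries.monomial a (scaledRow a)) = 0 := by
  ext1 v
  rw [pderivCoeff, Derivation.coeff_powerSeriesMap, PowerSeries.coeff_monomial]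
  split_ifs
  · rw [pderiv_powerSeriesMap_scaledRow, map_zero]
  · simp

theorem pderivCoeff_mul_flowSeries_pow (g q a : ℕ) :
    pderivCoeff a (oneSubInner ^ g * flowSeries ^ q) =
      q * (PowerSeries.monomial a (scaledRow a)) * (oneSubInner ^ g * flowSeries ^ (q - 1)) := by
  rw [Derivation.leibniz, Derivation.leibniz_pow, Derivation.leibniz_pow, pderivCoeff_oneSubInner,
    pderivCoeff_flowSeries]
  simp only [smul_eq_mul, nsmul_eq_mul, mul_zero, add_zero]
  ring

theorem derivInner_oneSubInner : derivInner oneSubInner = -1 := by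
  rw [derivInner, oneSubInner, Derivation.powerSeriesMap_C, ratDerivative_apply]
  simp

theorem scaledRow_zero_mul_oneSubInner :
    PowerSeries.monomial 0 (scaledRow 0) * oneSubInner = 1 := by
  have h : narayanaRow 0 = PowerSeries.mk 1 := by
    ext k
    simp [narayanaRow, narayana_zero_left]
  have h2 : PowerSeries.map (C : ℚ →+* MvPolynomial ℕ ℚ) (PowerSeries.mk 1) = PowerSeries.mk 1 := by
    ext1 k; simp
  rw [PowerSeries.monomial_zero_eq_C_apply, oneSubInner, ← map_mul, scaledRow, h, h2]
  simp [PowerSeries.mk_one_mul_one_sub_eq_one]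

theorem coeff_sum_eq_derivInner {n N : ℕ} (h : n < N) :
    PowerSeries.coeff n (∑ a ∈ Finset.range N, ∑ b ∈ Finset.range N,
      ((a + b + 2).choose (b + 1) : PowerSeries (PowerSeries (MvPolynomial ℕ ℚ))) *
        (PowerSeries.C (PowerSeries.C (X (a + b))) *
        (PowerSeries.monomial a (scaledRow a) * PowerSeries.monomial b (scaledRow b)))) =
      PowerSeries.coeff n (2 * derivInner flowSeries) := by
  have hterm : ∀ a b : ℕ, PowerSeries.coeff n
      (((a + b + 2).choose (b + 1) : PowerSeries (PowerSeries (MvPolynomial ℕ ℚ))) *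
        (PowerSeries.C (PowerSeries.C (X (a + b))) *
        (PowerSeries.monomial a (scaledRow a) * PowerSeries.monomial b (scaledRow b)))) =
      if n = a + b then ((n + 2).factorial : PowerSeries (MvPolynomial ℕ ℚ)) * PowerSeries.C (X n) *
        PowerSeries.map C (narayanaRow a * narayanaRow b) else 0 := by
    intro a b
    rw [PowerSeries.monomial_mul_monomial, ← map_natCast (PowerSeries.C),
      PowerSeries.coeff_C_mul, PowerSeries.coeff_C_mul, PowerSeries.coeff_monomial]
    split_ifs with hn
    · subst hn
      have hc := Nat.choose_mul_factorial_mul_factorial (show b + 1 ≤ a + b + 2 by omega)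
      rw [show a + b + 2 - (b + 1) = a + 1 by omega] at hc
      rw [← hc, scaledRow, scaledRow, map_mul]
      push_cast
      ring
    · simp
  simp only [map_sum, hterm]
  rw [← Finset.sum_product', ← Finset.sum_filter]
  have hset : (Finset.range N ×ˢ Finset.range N).filter (fun p => n = p.1 + p.2) =
      Finset.HasAntidiagonal.antidiagonal n := by
    ext p
    simp only [Finset.mem_filter, Finset.mem_product, Finset.mem_range, Finset.HasAntidiagonal.mem_antidiagonal]
    omega
  rw [hset, ← Finset.mul_sum, ← map_sum]
  have h2 := congrArg (PowerSeries.map (C : ℚ →+* MvPolynomial ℕ ℚ))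
    (two_mul_derivative_narayanaRow n)
  have hder : PowerSeries.map (C : ℚ →+* MvPolynomial ℕ ℚ)
      (PowerSeries.derivative ℚ (narayanaRow n)) =
      ratDerivative _ (PowerSeries.map (C : ℚ →+* MvPolynomial ℕ ℚ) (narayanaRow n)) := by
    ext1 k
    simp [ratDerivative_apply, PowerSeries.coeff_derivative]
  have hC : ratDerivative (MvPolynomial ℕ ℚ) (PowerSeries.C (X n)) = 0 := by
    rw [ratDerivative_apply, PowerSeries.derivative_C]
  rw [map_mul, hder, map_mul] at h2
  simp only [map_add, map_natCast, map_ofNat] at h2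
  rw [two_mul, map_add, derivInner, Derivation.coeff_powerSeriesMap, flowSeries,
    PowerSeries.coeff_mk, scaledRow, Derivation.leibniz, Derivation.leibniz, hC,
    Derivation.map_natCast, Nat.factorial_succ]
  simp only [smul_eq_mul, mul_zero, add_zero]
  push_cast
  linear_combination (-((n + 1).factorial : PowerSeries (MvPolynomial ℕ ℚ)) *
    PowerSeries.C (X n)) * h2

theorem coeff_coeff_C_C_mul {A : Type*} [CommRing A] (n k : ℕ) (x : A)
    (F : PowerSeries (PowerSeries A)) :
    PowerSeries.coeff k (PowerSeries.coeff n (PowerSeries.C (PowerSeries.C x) * F)) =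
      x * PowerSeries.coeff k (PowerSeries.coeff n F) := by
  rw [PowerSeries.coeff_C_mul, PowerSeries.coeff_C_mul]

theorem coeff_coeff_natCast_mul {A : Type*} [CommRing A] (n k c : ℕ)
    (F : PowerSeries (PowerSeries A)) :
    PowerSeries.coeff k (PowerSeries.coeff n ((c : PowerSeries (PowerSeries A)) * F)) =
      (c : A) * PowerSeries.coeff k (PowerSeries.coeff n F) := by
  rw [← coeff_coeff_C_C_mul, map_natCast, map_natCast]

theorem pderiv_coeff_coeff (a n k : ℕ) (F : PowerSeries (PowerSeries (MvPolynomial ℕ ℚ))) :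
    pderiv a (PowerSeries.coeff k (PowerSeries.coeff n F)) =
      PowerSeries.coeff k (PowerSeries.coeff n (pderivCoeff a F)) := by
  rw [pderivCoeff, Derivation.coeff_powerSeriesMap, Derivation.coeff_powerSeriesMap]

theorem pderivCoeff_pderivCoeff_mul_flowSeries_pow (g q a b : ℕ) :
    pderivCoeff a (pderivCoeff b (oneSubInner ^ g * flowSeries ^ (q + 1))) =
      (q + 1) * q * (PowerSeries.monomial a (scaledRow a) * PowerSeries.monomial b (scaledRow b)) *
        (oneSubInner ^ g * flowSeries ^ (q - 1)) := by
  rw [pderivCoeff_mul_flowSeries_pow, mul_assoc, Derivation.leibniz, Derivation.map_natCast,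
    Derivation.leibniz, pderivCoeff_monomial_scaledRow, Nat.add_sub_cancel,
    pderivCoeff_mul_flowSeries_pow]
  simp only [smul_eq_mul, mul_zero, add_zero]
  push_cast
  ring

theorem derivInner_mul_flowSeries_pow (g q : ℕ) :
    derivInner (oneSubInner ^ (g + 1) * flowSeries ^ q) =
      -(g + 1) * (oneSubInner ^ g * flowSeries ^ q) +
        q * derivInner flowSeries * (oneSubInner ^ (g + 1) * flowSeries ^ (q - 1)) := by
  rw [Derivation.leibniz, Derivation.leibniz_pow, Derivation.leibniz_pow, derivInner_oneSubInner]
  simp only [smul_eq_mul, nsmul_eq_mul, Nat.add_sub_cancel]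
  push_cast
  ring

theorem Dop_coeff_coeff (g q n k : ℕ) :
    Dop (g + 1) (PowerSeries.coeff k (PowerSeries.coeff n
      (oneSubInner ^ (g + 1) * flowSeries ^ (q + 1)))) =
    ((q + 1) * (k + 1) : ℚ) • PowerSeries.coeff (k + 1) (PowerSeries.coeff n
      (oneSubInner ^ (g + 1) * flowSeries ^ q)) := by
  obtain ⟨N, hN, hnN⟩ : ∃ N, (PowerSeries.coeff k (PowerSeries.coeff n
      (oneSubInner ^ (g + 1) * flowSeries ^ (q + 1)))).vars.sup id + 1 ≤ N ∧ n < N :=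
    ⟨_, le_max_left _ (n + 1), by simp⟩
  rw [Dop_eq_sum_range _ _ hN]
  set S := ∑ a ∈ Finset.range N, ∑ b ∈ Finset.range N,
      ((a + b + 2).choose (b + 1) : PowerSeries (PowerSeries (MvPolynomial ℕ ℚ))) *
        (PowerSeries.C (PowerSeries.C (X (a + b))) *
        (PowerSeries.monomial a (scaledRow a) * PowerSeries.monomial b (scaledRow b))) with hS
  set H : PowerSeries (PowerSeries (MvPolynomial ℕ ℚ)) :=
    (q + 1) * q * (oneSubInner ^ (g + 1) * flowSeries ^ (q - 1)) with hH
  have hsum : ∑ a ∈ Finset.range N, ∑ b ∈ Finset.range N,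
      ((a + b + 2).choose (b + 1) : ℚ) • (X (a + b) * pderiv a (pderiv b (PowerSeries.coeff k
        (PowerSeries.coeff n (oneSubInner ^ (g + 1) * flowSeries ^ (q + 1)))))) =
      PowerSeries.coeff k (PowerSeries.coeff n (S * H)) := by
    simp only [hS, Finset.sum_mul, map_sum]
    refine Finset.sum_congr rfl fun a _ => Finset.sum_congr rfl fun b _ => ?_
    rw [pderiv_coeff_coeff, pderiv_coeff_coeff, pderivCoeff_pderivCoeff_mul_flowSeries_pow,
      MvPolynomial.smul_eq_C_mul, map_natCast, ← coeff_coeff_C_C_mul, ← coeff_coeff_natCast_mul,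
      hH]
    refine congrArg (fun F => PowerSeries.coeff k (PowerSeries.coeff n F)) ?_
    ring
  have hSH : PowerSeries.coeff n (S * H) =
      PowerSeries.coeff n (2 * derivInner flowSeries * H) := by
    rw [PowerSeries.coeff_mul, PowerSeries.coeff_mul]
    refine Finset.sum_congr rfl fun p hp => ?_
    have hp' := Finset.HasAntidiagonal.mem_antidiagonal.mp hp
    rw [hS, coeff_sum_eq_derivInner (show p.1 < N by omega)]
  have hderiv : ∀ F, PowerSeries.coeff k (PowerSeries.coeff n (derivInner F)) =
      PowerSeries.coeff (k + 1) (PowerSeries.coeff n F) * (k + 1) := by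
    intro F
    rw [derivInner, Derivation.coeff_powerSeriesMap, ratDerivative_apply,
      PowerSeries.coeff_derivative]
  have hfirst : pderivCoeff 0 (oneSubInner ^ (g + 1) * flowSeries ^ (q + 1)) =
      (q + 1) * (oneSubInner ^ g * flowSeries ^ q) := by
    rw [pderivCoeff_mul_flowSeries_pow, Nat.add_sub_cancel]
    push_cast
    linear_combination ((q : PowerSeries (PowerSeries (MvPolynomial ℕ ℚ))) + 1) *
      oneSubInner ^ g * flowSeries ^ q * scaledRow_zero_mul_oneSubInner
  have hmain := hderiv (oneSubInner ^ (g + 1) * flowSeries ^ q)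
  rw [hsum, hSH, pderiv_coeff_coeff, hfirst]
  rw [derivInner_mul_flowSeries_pow, map_add, map_add] at hmain
  have e1 := coeff_coeff_natCast_mul n k (g + 1) (oneSubInner ^ g * flowSeries ^ q)
  have e2 := coeff_coeff_natCast_mul n k q (derivInner flowSeries * (oneSubInner ^ (g + 1) * flowSeries ^ (q - 1)))
  have e3 := coeff_coeff_natCast_mul n k (q + 1) (oneSubInner ^ g * flowSeries ^ q)
  have e4 := coeff_coeff_natCast_mul n k (2 * (q + 1) * q)
    (derivInner flowSeries * (oneSubInner ^ (g + 1) * flowSeries ^ (q - 1)))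
  push_cast at e1 e2 e3 e4
  rw [neg_mul, map_neg, map_neg, e1, mul_assoc _ (derivInner flowSeries), e2] at hmain
  rw [e3, hH, show 2 * derivInner flowSeries * ((q + 1) * q * (oneSubInner ^ (g + 1) *
    flowSeries ^ (q - 1))) = 2 * (q + 1) * q * (derivInner flowSeries * (oneSubInner ^ (g + 1) *
    flowSeries ^ (q - 1))) by ring, e4]
  simp only [MvPolynomial.smul_eq_C_mul]
  have hhalf : (C (1 / 2) : MvPolynomial ℕ ℚ) * 2 = 1 := by
    rw [show (2 : MvPolynomial ℕ ℚ) = C 2 from rfl, ← map_mul]; norm_num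
  simp only [map_neg, map_natCast, map_mul, map_add, map_one]
  push_cast
  linear_combination ((q : MvPolynomial ℕ ℚ) + 1) * hmain + (q + 1) * q * PowerSeries.coeff k
    (PowerSeries.coeff n (derivInner flowSeries *
      (oneSubInner ^ (g + 1) * flowSeries ^ (q - 1)))) * hhalf

theorem Dop_smul (g : ℕ) (c : ℚ) (p : MvPolynomial ℕ ℚ) : Dop g (c • p) = c • Dop g p := by
  rw [Dop_eq_sum_range g p (le_max_left _ ((c • p).vars.sup id + 1)),
    Dop_eq_sum_range g (c • p) (le_max_right (p.vars.sup id + 1) _)]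
  simp only [Derivation.map_smul, smul_add, Finset.smul_sum, mul_smul_comm]
  congr 1
  · rw [smul_comm]
  · refine Finset.sum_congr rfl fun a _ => Finset.sum_congr rfl fun b _ => ?_
    rw [smul_comm _ c (X _ * _), smul_comm _ c]

theorem iterate_Dop_coeff_coeff (g n q m : ℕ) :
    (Dop (g + 1))^[m] (PowerSeries.coeff 0 (PowerSeries.coeff n
      (oneSubInner ^ (g + 1) * flowSeries ^ (q + m)))) =
    ((q + m).descFactorial m * m.factorial : ℚ) • PowerSeries.coeff m (PowerSeries.coeff n
      (oneSubInner ^ (g + 1) * flowSeries ^ q)) := by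
  induction m generalizing q with
  | zero => simp
  | succ m ih =>
    rw [Function.iterate_succ_apply', show q + (m + 1) = q + 1 + m by ring, ih (q + 1),
      Dop_smul, Dop_coeff_coeff, smul_smul]
    congr 1
    have h := Nat.descFactorial_succ (q + 1 + m) m
    rw [show q + 1 + m - m = q + 1 by omega] at h
    rw [h, Nat.factorial_succ]
    push_cast
    ring

theorem PowerSeries.coeff_one_sub_X_pow (g b : ℕ) :
    PowerSeries.coeff b ((1 - PowerSeries.X : PowerSeries ℚ) ^ g) = (-1) ^ b * g.choose b := by
  have h : (1 - PowerSeries.X : PowerSeries ℚ) ^ g =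
      PowerSeries.rescale (-1) ((1 + Polynomial.X : Polynomial ℚ) ^ g : Polynomial ℚ) := by
    simp [sub_eq_add_neg]
  rw [h, PowerSeries.coeff_rescale, Polynomial.coeff_coe, Polynomial.coeff_one_add_X_pow]

theorem coeff_coeff_oneSubInner_mul_flowSeries (g n m : ℕ) :
    PowerSeries.coeff m (PowerSeries.coeff n (oneSubInner ^ g * flowSeries ^ 1)) =
      ((n + 1).factorial * ∑ b ∈ Finset.range (m + 1),
        (-1) ^ b * (g.choose b : ℚ) * narayana n (m - b) : ℚ) • X n := by
  have h : PowerSeries.coeff n (oneSubInner ^ g * flowSeries ^ 1) =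
      PowerSeries.C (X n * ((n + 1).factorial : MvPolynomial ℕ ℚ)) *
        PowerSeries.map C ((1 - PowerSeries.X) ^ g * narayanaRow n) := by
    rw [pow_one, oneSubInner, ← map_pow, PowerSeries.coeff_C_mul, flowSeries, PowerSeries.coeff_mk,
      scaledRow, map_mul, map_mul, map_pow, map_sub, map_one, PowerSeries.map_X, map_natCast]
    ring
  have hsum : PowerSeries.coeff m ((1 - PowerSeries.X) ^ g * narayanaRow n) =
      ∑ b ∈ Finset.range (m + 1), (-1) ^ b * (g.choose b : ℚ) * narayana n (m - b) := by
    rw [PowerSeries.coeff_mul, Finset.Nat.sum_antidiagonal_eq_sum_range_succ_mk]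
    simp only [PowerSeries.coeff_one_sub_X_pow, narayanaRow, PowerSeries.coeff_mk]
  rw [h, PowerSeries.coeff_C_mul, PowerSeries.coeff_map, hsum, MvPolynomial.smul_eq_C_mul, map_mul,
    map_natCast]
  ring

theorem coeff_zero_coeff_oneSubInner_mul_flowSeries_pow (g n r : ℕ) :
    PowerSeries.coeff 0 (PowerSeries.coeff n (oneSubInner ^ g * flowSeries ^ r)) =
      Bpol (n + r) r := by
  have hmap : ∀ F : PowerSeries (PowerSeries (MvPolynomial ℕ ℚ)),
      PowerSeries.coeff 0 (PowerSeries.coeff n F) =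
        PowerSeries.coeff n (PowerSeries.map PowerSeries.constantCoeff F) := by
    intro F
    rw [PowerSeries.coeff_map, PowerSeries.coeff_zero_eq_constantCoeff_apply]
  have hU : PowerSeries.map PowerSeries.constantCoeff oneSubInner = 1 := by
    rw [oneSubInner, PowerSeries.map_C]; simp
  have hY : ∀ v, PowerSeries.coeff v (PowerSeries.map PowerSeries.constantCoeff flowSeries) =
      ((v + 1).factorial : ℚ) • X v := by
    intro v
    rw [PowerSeries.coeff_map, flowSeries, PowerSeries.coeff_mk, scaledRow, map_mul, map_mul,
      map_natCast, ← PowerSeries.coeff_zero_eq_constantCoeff_apply (PowerSeries.map _ _),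
      PowerSeries.coeff_map, narayanaRow, PowerSeries.coeff_mk, narayana_zero_right,
      MvPolynomial.smul_eq_C_mul, map_natCast]
    simp [mul_comm]
  rw [hmap, map_mul, map_pow, map_pow, hU, one_pow, one_mul,
    show PowerSeries.map PowerSeries.constantCoeff flowSeries ^ r =
      ∏ _k : Fin r, PowerSeries.map PowerSeries.constantCoeff flowSeries by simp,
    PowerSeries.coeff_prod, Bpol]
  simp only [hY]
  refine Finset.sum_nbij' (fun l k => l k + 1)
    (fun m => Finsupp.equivFunOnFinite.symm fun k => m k - 1) ?_ ?_ ?_ ?_ ?_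
  · intro l hl
    have hl' := (Finset.mem_finsuppAntidiag.mp hl).1
    simp [Finset.Nat.mem_antidiagonalTuple, Finset.sum_add_distrib, hl']
  · intro m hm
    rw [Finset.mem_filter, Finset.Nat.mem_antidiagonalTuple] at hm
    have h : ∑ k, (m k - 1 + 1) = n + r :=
      (Finset.sum_congr rfl fun k _ => Nat.sub_add_cancel (hm.2 k)).trans hm.1
    simp only [Finset.sum_add_distrib, Finset.sum_const, Finset.card_univ, Fintype.card_fin,
      smul_eq_mul, mul_one] at h
    simpa [Finset.mem_finsuppAntidiag] using h
  · intro l _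
    ext k
    simp
  · intro m hm
    funext k
    have := (Finset.mem_filter.mp hm).2 k
    simp only [Finsupp.equivFunOnFinite_symm_apply_apply]
    omega
  · intro l _
    simp only [Nat.add_sub_cancel]
    rw [Finset.prod_smul]

/-- for all `r ≥ 1` and `i ≥ r`,
`𝒟^{r−1}(B(i, r)) = r!·(r−1)!·(i−r)!·Ψ(g, i, r)·x_{i+1−r}`. -/
theorem stmt13 (g : ℕ) (hg : 3 ≤ g) (r i : ℕ) (hr : 1 ≤ r) (hi : r ≤ i) :
    (Dop g)^[r - 1] (Bpol i r) =
      ((r.factorial : ℚ) * (r - 1).factorial * (i - r).factorial * Psi g i r) •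
        X (i - r) := by
  obtain ⟨m, rfl⟩ : ∃ m, r = m + 1 := ⟨r - 1, by omega⟩
  obtain ⟨n, rfl⟩ : ∃ n, i = n + (m + 1) := ⟨i - (m + 1), by omega⟩
  obtain ⟨g, rfl⟩ : ∃ g', g = g' + 1 := ⟨g - 1, by omega⟩
  have h := iterate_Dop_coeff_coeff g n 1 m
  rw [coeff_zero_coeff_oneSubInner_mul_flowSeries_pow, coeff_coeff_oneSubInner_mul_flowSeries,
    smul_smul, add_comm 1 m] at h
  rw [Nat.add_sub_cancel, Nat.add_sub_cancel, h, Psi_eq_sum]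
  congr 1
  have hdesc : (m + 1).descFactorial m = (m + 1).factorial := by
    simpa using Nat.factorial_mul_descFactorial (show m ≤ m + 1 by omega)
  rw [hdesc, Nat.factorial_succ n, Finset.mul_sum, Finset.mul_sum, Finset.mul_sum]
  refine Finset.sum_congr rfl fun b _ => ?_
  rw [narayana]
  push_cast
  field_simp
end
end
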